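/- Let Q be a natural join query on m relations and n attributes with a fixed GAO, and let I be an indexed database instance with N total tuples across all input relations. Let r = max_{R ∈ atoms(Q)} arity(R) ≤ n. Then there exists an argument A that is satisfied by I and is a certificate, with |A| ≤ r · N. -/

import Mathlib

/-! Core model of indexed natural-join queries, arguments and certificates. -/

/-- `x` is a valid index tuple for a search tree with fanout function `f` and depth
(arity) `ar`: it is nonempty, of length at most `ar`, and every coordinate is `1`-based
and within the fanout of the corresponding prefix. -/
def ValidIdx (f : List ℕ → ℕ) (ar : ℕ) (x : List ℕ) : Prop :=
  x ≠ [] ∧ x.length ≤ ar ∧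
    ∀ j : Fin x.length, 1 ≤ x.get j ∧ x.get j ≤ f (x.take j.val)

/-- `v` is a valid valuation (a "database instance") for the search-tree shape `(f, ar)`:
the values assigned to the children of a common prefix strictly increase. -/
def IsInstVal (f : List ℕ → ℕ) (ar : ℕ) (v : List ℕ → ℕ) : Prop :=
  ∀ (x : List ℕ) (i : ℕ), ValidIdx f ar (x ++ [i]) → ValidIdx f ar (x ++ [i + 1]) →
    v (x ++ [i]) < v (x ++ [i + 1])

/-- A symbolic comparison `R[x] θ S[y]` between two variables, `θ ∈ {<, =, >}`. -/
structure Comp (ι : Type) where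
  R : ι
  x : List ℕ
  S : ι
  y : List ℕ
  o : Ordering
deriving DecidableEq

variable {n : ℕ} {ι : Type}

/-- The list of attributes of relation `R`, in the order of the GAO `ρ`. -/
def attrList (attrs : ι → Finset (Fin n)) (ρ : List (Fin n)) (R : ι) : List (Fin n) :=
  ρ.filter (fun a => decide (a ∈ attrs R))

/-- The arity of relation `R`. -/
def arity (attrs : ι → Finset (Fin n)) (ρ : List (Fin n)) (R : ι) : ℕ :=
  (attrList attrs ρ R).length

/-- Well-formedness of a comparison: both index tuples are valid, and the two variables
are on the same attribute. -/
def CompWF (attrs : ι → Finset (Fin n)) (ρ : List (Fin n)) (f : ι → List ℕ → ℕ)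
    (c : Comp ι) : Prop :=
  ValidIdx (f c.R) (arity attrs ρ c.R) c.x ∧
  ValidIdx (f c.S) (arity attrs ρ c.S) c.y ∧
  (attrList attrs ρ c.R)[c.x.length - 1]? = (attrList attrs ρ c.S)[c.y.length - 1]?

/-- The valuation `v` satisfies the comparison `c`. -/
def SatComp (v : ι → List ℕ → ℕ) (c : Comp ι) : Prop :=
  compare (v c.R c.x) (v c.S c.y) = c.o

/-- `W` is a witness: one full valid index tuple per relation, all contributing to a common
output tuple `t`. -/
def IsWitness (attrs : ι → Finset (Fin n)) (ρ : List (Fin n)) (f : ι → List ℕ → ℕ)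
    (v : ι → List ℕ → ℕ) (W : ι → List ℕ) : Prop :=
  (∀ R, ValidIdx (f R) (arity attrs ρ R) (W R) ∧ (W R).length = arity attrs ρ R) ∧
  ∃ t : Fin n → ℕ, ∀ (R : ι) (j : ℕ) (a : Fin n),
    (attrList attrs ρ R)[j]? = some a → v R ((W R).take (j + 1)) = t a

/-- `A` is a certificate for the shape `f`: all its comparisons are well-formed, and any two
valuations (database instances with this index structure) satisfying all comparisons of `A`
have exactly the same witnesses. -/
def IsCert (attrs : ι → Finset (Fin n)) (ρ : List (Fin n)) (f : ι → List ℕ → ℕ)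
    (A : Finset (Comp ι)) : Prop :=
  (∀ c ∈ A, CompWF attrs ρ f c) ∧
  ∀ v v' : ι → List ℕ → ℕ,
    (∀ R, IsInstVal (f R) (arity attrs ρ R) (v R)) →
    (∀ R, IsInstVal (f R) (arity attrs ρ R) (v' R)) →
    (∀ c ∈ A, SatComp v c) → (∀ c ∈ A, SatComp v' c) →
    ∀ W, IsWitness attrs ρ f v W ↔ IsWitness attrs ρ f v' W

/-! The search tree (trie) derived from raw relational data. -/

/-- The `k`-th smallest element of a finite set of naturals (`1`-based). -/
def nthVal (s : Finset ℕ) (k : ℕ) : ℕ := (s.sort (· ≤ ·)).getD (k - 1) 0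

/-- The list of values along the path of index tuple `x` in the search tree of the data
`D` with attribute list `L`. -/
def dbValList : List ℕ → Finset (Fin n → ℕ) → List (Fin n) → List ℕ
  | [], _, _ => []
  | _ :: _, _, [] => []
  | i :: xs, D, a :: L' =>
    let w := nthVal (D.image (fun t => t a)) i
    w :: dbValList xs (D.filter (fun t => t a = w)) L'

/-- The fanout below index tuple `x` in the search tree of the data `D` with attribute
list `L`. -/
def dbFanout : List ℕ → Finset (Fin n → ℕ) → List (Fin n) → ℕ
  | _, _, [] => 0
  | [], D, a :: _ => (D.image (fun t => t a)).card
  | i :: xs, D, a :: L' =>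
    let w := nthVal (D.image (fun t => t a)) i
    dbFanout xs (D.filter (fun t => t a = w)) L'

/-- The index structure (shape) of the database `DB`, indexed consistently with the GAO
`ρ`. -/
def dbShape (attrs : ι → Finset (Fin n)) (ρ : List (Fin n))
    (DB : ι → Finset (Fin n → ℕ)) : ι → List ℕ → ℕ :=
  fun R x => dbFanout x (DB R) (attrList attrs ρ R)

/-- The value of the variable `R[x]` in the search trees of the database `DB`, indexed
consistently with the GAO `ρ`. -/
def dbValue (attrs : ι → Finset (Fin n)) (ρ : List (Fin n))
    (DB : ι → Finset (Fin n → ℕ)) : ι → List ℕ → ℕ :=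
  fun R x => (dbValList x (DB R) (attrList attrs ρ R)).getD (x.length - 1) 0

lemma compare_eq_compare_iff_nat (a b c d : ℕ) :
    compare a b = compare c d ↔ (a < b ↔ c < d) ∧ (b < a ↔ d < c) := by
  rcases lt_trichotomy a b with h | h | h <;> rcases lt_trichotomy c d with h' | h' | h' <;>
    simp [compare_lt_iff_lt.mpr, compare_gt_iff_gt.mpr, h, h', h.le, h'.le, not_lt.mpr]

/-- Finitely many elements partitioned into classes can be compared within each class using
at most one symbolic comparison per element. -/
lemma exists_comparisons_card_le {α β : Type*} [DecidableEq α] (cls : α → β) (g : α → ℕ)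
    (V : Finset α) :
    ∃ C : Finset (α × α), C.card ≤ V.card ∧
      (∀ p ∈ C, p.1 ∈ V ∧ p.2 ∈ V ∧ cls p.1 = cls p.2) ∧
      ∀ h : α → ℕ, (∀ p ∈ C, compare (h p.1) (h p.2) = compare (g p.1) (g p.2)) →
        ∀ x ∈ V, ∀ y ∈ V, cls x = cls y → compare (h x) (h y) = compare (g x) (g y) := by
  classical
  induction V using Finset.induction_on_max_value g with
  | empty => exact ⟨∅, by simp⟩
  | insert p V hp hmax ih =>
    obtain ⟨C, hcard, hC, hdet⟩ := ih
    rcases (V.filter fun q => cls q = cls p).eq_empty_or_nonempty with hempty | hne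
    · have hfresh : ∀ q ∈ V, cls q ≠ cls p := Finset.filter_eq_empty_iff.mp hempty
      refine ⟨C, by rw [Finset.card_insert_of_notMem hp]; omega, ?_, ?_⟩
      · intro q hq
        obtain ⟨h₁, h₂, h₃⟩ := hC q hq
        exact ⟨Finset.mem_insert_of_mem h₁, Finset.mem_insert_of_mem h₂, h₃⟩
      · intro h hh x hx y hy hxy
        rcases Finset.mem_insert.mp hx with rfl | hxV <;>
          rcases Finset.mem_insert.mp hy with rfl | hyV
        · simp
        · exact absurd hxy.symm (hfresh y hyV)
        · exact absurd hxy (hfresh x hxV)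
        · exact hdet h hh x hxV y hyV hxy
    · obtain ⟨q, hq, hqmax⟩ := Finset.exists_max_image _ g hne
      obtain ⟨hqV, hqp⟩ := Finset.mem_filter.mp hq
      refine ⟨insert (q, p) C, ?_, ?_, ?_⟩
      · rw [Finset.card_insert_of_notMem hp]
        exact (Finset.card_insert_le _ _).trans (by omega)
      · intro s hs
        rcases Finset.mem_insert.mp hs with rfl | hs
        · exact ⟨Finset.mem_insert_of_mem hqV, Finset.mem_insert_self _ _, hqp⟩
        · obtain ⟨h₁, h₂, h₃⟩ := hC s hs
          exact ⟨Finset.mem_insert_of_mem h₁, Finset.mem_insert_of_mem h₂, h₃⟩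
      · intro h hh
        have hold := hdet h fun s hs => hh s (Finset.mem_insert_of_mem hs)
        have hqp_cmp := hh (q, p) (Finset.mem_insert_self _ _)
        simp only [compare_eq_compare_iff_nat] at hold hqp_cmp ⊢
        have hnew : ∀ x ∈ V, cls x = cls p →
            (h x < h p ↔ g x < g p) ∧ (h p < h x ↔ g p < g x) := by
          intro x hx hxp
          have h₁ := hold x hx q hqV (hxp.trans hqp.symm)
          have h₂ := hqmax x (Finset.mem_filter.mpr ⟨hx, hxp⟩)
          have h₃ := hmax q hqV
          omega
        intro x hx y hy hxy
        rcases Finset.mem_insert.mp hx with rfl | hxV <;>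
          rcases Finset.mem_insert.mp hy with rfl | hyV
        · simp
        · exact (hnew y hyV hxy.symm).symm
        · exact hnew x hxV hxy
        · exact hold x hxV y hyV hxy

lemma ValidIdx.take {f : List ℕ → ℕ} {ar : ℕ} {x : List ℕ} (hx : ValidIdx f ar x) {k : ℕ}
    (hk : 0 < k) : ValidIdx f ar (x.take k) := by
  obtain ⟨hne, hlen, hval⟩ := hx
  refine ⟨by simp [hne, hk.ne'], by rw [List.length_take]; omega, ?_⟩
  rintro ⟨j, hj⟩
  rw [List.length_take] at hj
  have := hval ⟨j, by omega⟩
  simp only [List.get_eq_getElem, List.getElem_take, List.take_take] at this ⊢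
  rwa [min_eq_left (by omega)]

lemma ValidIdx.head {f : List ℕ → ℕ} {ar i : ℕ} {xs : List ℕ} (hx : ValidIdx f ar (i :: xs)) :
    1 ≤ i ∧ i ≤ f [] := by
  simpa using hx.2.2 ⟨0, by simp⟩

lemma ValidIdx.tail {f : List ℕ → ℕ} {ar i : ℕ} {xs : List ℕ}
    (hx : ValidIdx f (ar + 1) (i :: xs)) (hxs : xs ≠ []) :
    ValidIdx (fun y => f (i :: y)) ar xs := by
  obtain ⟨-, hlen, hval⟩ := hx
  refine ⟨hxs, by simpa using hlen, fun j => ?_⟩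
  simpa using hval j.succ

lemma nthVal_injOn (s : Finset ℕ) : Set.InjOn (nthVal s) (Finset.Icc 1 s.card) := by
  intro i hi j hj hij
  simp only [Finset.coe_Icc, Set.mem_Icc] at hi hj
  have hi' : i - 1 < (s.sort (· ≤ ·)).length := by rw [Finset.length_sort]; omega
  have hj' : j - 1 < (s.sort (· ≤ ·)).length := by rw [Finset.length_sort]; omega
  simp only [nthVal, List.getD_eq_getElem _ _ hi', List.getD_eq_getElem _ _ hj'] at hij
  have := (s.sort_nodup (· ≤ ·)).getElem_inj_iff.mp hij
  omega

/-- The search tree of `D` has at most `|D|` nodes on each level. -/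
lemma exists_finset_validIdx_card_le {n : ℕ} (L : List (Fin n)) (D : Finset (Fin n → ℕ)) :
    ∃ S : Finset (List ℕ),
      (∀ x, ValidIdx (fun y => dbFanout y D L) L.length x → x ∈ S) ∧
      S.card ≤ L.length * D.card := by
  classical
  induction L generalizing D with
  | nil =>
    exact ⟨∅, fun x hx => absurd (List.length_eq_zero_iff.mp (Nat.le_zero.mp hx.2.1)) hx.1,
      by simp⟩
  | cons a L ih =>
    let s := D.image fun t => t a
    let E : ℕ → Finset (Fin n → ℕ) := fun i => D.filter fun t => t a = nthVal s i
    choose S hmem hcard using ih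
    refine ⟨(Finset.Icc 1 s.card).biUnion fun i => insert [i] ((S (E i)).image (List.cons i)),
      ?_, ?_⟩
    · rintro (_ | ⟨i, xs⟩) hx
      · exact absurd rfl hx.1
      · refine Finset.mem_biUnion.mpr ⟨i, Finset.mem_Icc.mpr hx.head, ?_⟩
        rcases eq_or_ne xs [] with rfl | hxs
        · exact Finset.mem_insert_self _ _
        · exact Finset.mem_insert_of_mem
            (Finset.mem_image_of_mem _ (hmem (E i) xs (hx.tail hxs)))
    · have hdisj : ∑ i ∈ Finset.Icc 1 s.card, (E i).card ≤ D.card := by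
        rw [← Finset.card_biUnion]
        · exact Finset.card_le_card
            (Finset.biUnion_subset.mpr fun i _ => Finset.filter_subset _ _)
        · intro i hi j hj hij
          refine Finset.disjoint_left.mpr fun t hti htj => hij (nthVal_injOn s hi hj ?_)
          exact (Finset.mem_filter.mp hti).2.symm.trans (Finset.mem_filter.mp htj).2
      calc _ ≤ ∑ i ∈ Finset.Icc 1 s.card, (L.length * (E i).card + 1) :=
            Finset.card_biUnion_le.trans <| Finset.sum_le_sum fun i _ =>
              (Finset.card_insert_le _ _).trans <| Nat.add_le_add_right
                (Finset.card_image_le.trans (hcard _)) 1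
        _ = L.length * ∑ i ∈ Finset.Icc 1 s.card, (E i).card + s.card := by
            simp [Finset.sum_add_distrib, Finset.mul_sum]
        _ ≤ L.length * D.card + D.card :=
            Nat.add_le_add (Nat.mul_le_mul_left _ hdisj) Finset.card_image_le
        _ = (a :: L).length * D.card := by rw [List.length_cons]; ring

lemma isWitness_iff {n : ℕ} {ι : Type} {attrs : ι → Finset (Fin n)} {ρ : List (Fin n)}
    {f v : ι → List ℕ → ℕ} {W : ι → List ℕ} :
    IsWitness attrs ρ f v W ↔
      (∀ R, ValidIdx (f R) (arity attrs ρ R) (W R) ∧ (W R).length = arity attrs ρ R) ∧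
      ∀ R j S k a, (attrList attrs ρ R)[j]? = some a → (attrList attrs ρ S)[k]? = some a →
        v R ((W R).take (j + 1)) = v S ((W S).take (k + 1)) := by
  classical
  refine and_congr_right fun _ => ⟨?_, fun h => ?_⟩
  · rintro ⟨t, ht⟩ R j S k a hR hS
    rw [ht R j a hR, ht S k a hS]
  · refine ⟨fun a => if ha : ∃ p : ι × ℕ, (attrList attrs ρ p.1)[p.2]? = some a then
      v ha.choose.1 ((W ha.choose.1).take (ha.choose.2 + 1)) else 0, fun R j a hR => ?_⟩
    have ha : ∃ p : ι × ℕ, (attrList attrs ρ p.1)[p.2]? = some a := ⟨(R, j), hR⟩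
    simp only [dif_pos ha]
    exact h _ _ _ _ a hR ha.choose_spec

lemma arity_le_card {n : ℕ} {ι : Type} (attrs : ι → Finset (Fin n)) {ρ : List (Fin n)}
    (hnd : ρ.Nodup) (R : ι) : arity attrs ρ R ≤ (attrs R).card := by
  rw [arity, ← List.toFinset_card_of_nodup (l := attrList attrs ρ R) (hnd.filter _)]
  refine Finset.card_le_card fun a ha => ?_
  simpa using (List.mem_filter.mp (List.mem_toFinset.mp ha)).2

/-- Upper bound on the optimal certificate size: for any join query on relations `attrs`,
any GAO `ρ`, and any database with `N` tuples in total, there is a certificate satisfied by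
the database of size at most `r ⬝ N`, where `r` is the maximum arity. -/
theorem stmt_4 {n : ℕ} {ι : Type} [Fintype ι] [DecidableEq ι]
    (attrs : ι → Finset (Fin n)) (ρ : List (Fin n)) (hnd : ρ.Nodup) (hall : ∀ a : Fin n, a ∈ ρ)
    (DB : ι → Finset (Fin n → ℕ))
    (hsupp : ∀ R, ∀ t ∈ DB R, ∀ a, a ∉ attrs R → t a = 0)
    (r N : ℕ) (hr : r = Finset.univ.sup fun R : ι => (attrs R).card)
    (hN : N = ∑ R : ι, (DB R).card) :
    ∃ A : Finset (Comp ι),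
      IsCert attrs ρ (dbShape attrs ρ DB) A ∧
      (∀ c ∈ A, SatComp (dbValue attrs ρ DB) c) ∧
      A.card ≤ r * N := by
  classical
  set f := dbShape attrs ρ DB
  choose S hS hScard using fun R => exists_finset_validIdx_card_le (attrList attrs ρ R) (DB R)
  let V : Finset (ι × List ℕ) := (Finset.univ.sigma S).image (fun p => (p.1, p.2)) |>.filter
    fun p => ValidIdx (f p.1) (arity attrs ρ p.1) p.2
  have hV : ∀ p, p ∈ V ↔ ValidIdx (f p.1) (arity attrs ρ p.1) p.2 := by
    rintro ⟨R, x⟩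
    refine ⟨fun h => (Finset.mem_filter.mp h).2, fun h => Finset.mem_filter.mpr ⟨?_, h⟩⟩
    exact Finset.mem_image.mpr ⟨⟨R, x⟩, Finset.mem_sigma.mpr ⟨Finset.mem_univ R, hS R x h⟩, rfl⟩
  have hVcard : V.card ≤ r * N := by
    calc V.card ≤ ∑ R, (S R).card := by
          rw [← Finset.card_sigma]
          exact (Finset.card_filter_le _ _).trans Finset.card_image_le
      _ ≤ ∑ R, r * (DB R).card := Finset.sum_le_sum fun R _ =>
          (hScard R).trans <| Nat.mul_le_mul_right _ <| (arity_le_card attrs hnd R).trans <|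
            hr ▸ Finset.le_sup (f := fun R => (attrs R).card) (Finset.mem_univ R)
      _ = r * N := by rw [hN, Finset.mul_sum]
  let g : ι × List ℕ → ℕ := fun p => dbValue attrs ρ DB p.1 p.2
  obtain ⟨C, hCcard, hC, hdet⟩ := exists_comparisons_card_le
    (fun p : ι × List ℕ => (attrList attrs ρ p.1)[p.2.length - 1]?) g V
  refine ⟨C.image fun p => ⟨p.1.1, p.1.2, p.2.1, p.2.2, compare (g p.1) (g p.2)⟩, ⟨?_, ?_⟩, ?_,
    Finset.card_image_le.trans (hCcard.trans hVcard)⟩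
  · refine Finset.forall_mem_image.mpr fun p hp => ?_
    obtain ⟨h₁, h₂, h₃⟩ := hC p hp
    exact ⟨(hV _).mp h₁, (hV _).mp h₂, h₃⟩
  · intro v v' _ _ hv hv' W
    have hvg := hdet (fun p => v p.1 p.2) (Finset.forall_mem_image.mp hv)
    have hvg' := hdet (fun p => v' p.1 p.2) (Finset.forall_mem_image.mp hv')
    rw [isWitness_iff, isWitness_iff]
    refine and_congr_right fun hW => ?_
    have htake : ∀ R j a, (attrList attrs ρ R)[j]? = some a →
        (R, (W R).take (j + 1)) ∈ V ∧ ((W R).take (j + 1)).length - 1 = j := by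
      intro R j a hj
      refine ⟨(hV _).mpr ((hW R).1.take j.succ_pos), ?_⟩
      obtain ⟨hlt, -⟩ := List.getElem?_eq_some_iff.mp hj
      have hlen : (W R).length = (attrList attrs ρ R).length := (hW R).2
      rw [List.length_take]
      omega
    refine forall₅_congr fun R j T k a => forall₂_congr fun hR hT => ?_
    obtain ⟨hRV, hRlen⟩ := htake R j a hR
    obtain ⟨hTV, hTlen⟩ := htake T k a hT
    have hcls : (attrList attrs ρ R)[((W R).take (j + 1)).length - 1]? =
        (attrList attrs ρ T)[((W T).take (k + 1)).length - 1]? := by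
      rw [hRlen, hTlen, hR, hT]
    rw [← compare_eq_iff_eq, ← compare_eq_iff_eq (a := v' _ _)]
    exact (((hvg _ hRV _ hTV hcls).trans (hvg' _ hRV _ hTV hcls).symm).congr_left)
  · exact Finset.forall_mem_image.mpr fun p _ => rfl
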